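/- The empty string ε belongs to X, and for every nonempty circuit encoding v (that is, every nonempty v ∈ X ∪ Y): v ∈ X if and only if v ∈ (({a}*·{b})·Y) ∩ (L₀·Y), and v ∈ Y if and only if v ∈ (({a}*·{b})·X) ∪ (L₀·X). (This is the formal statement underlying the 8-rule conjunctive grammar: on well-formed circuit encodings, the sets of value-1 and value-0 circuits satisfy T = AbF ∩ CF ∪ {ε} and F = AbT ∪ CT with Ab = {a}*{b} and C = L₀.) -/

import Mathlib

/-- The two-letter alphabet Σ = {a, b}. -/
inductive Letter : Type
  | a
  | b
deriving DecidableEq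

/-- The encoding of the sequential NOR circuit with `n` gates and indices `j`:
the string a^{n−jₙ−1} b · a^{(n−1)−jₙ₋₁−1} b · ⋯ · a^{2−j₂−1} b, where the
one-gate circuit is encoded by the empty string ε. -/
def encC (j : ℕ → ℕ) : ℕ → List Letter
  | 0 => []
  | 1 => []
  | (i + 2) =>
      (List.replicate ((i + 2) - j (i + 2) - 1) Letter.a ++ [Letter.b]) ++
        encC j (i + 1)

/-- The indices j₂, …, jₙ of a sequential NOR circuit satisfy 1 ≤ jᵢ < i. -/
def ValidIdx (j : ℕ → ℕ) (n : ℕ) : Prop :=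
  ∀ i, 2 ≤ i → i ≤ n → 1 ≤ j i ∧ j i < i

/-- `x` gives the gate values of the circuit with indices `j` and `n` gates:
x₁ = 1 and xᵢ = ¬(xᵢ₋₁ ∨ x_{jᵢ}) for 2 ≤ i ≤ n. -/
def GateVals (j : ℕ → ℕ) (n : ℕ) (x : ℕ → Bool) : Prop :=
  x 1 = true ∧ ∀ i, 2 ≤ i → i ≤ n → x i = !(x (i - 1) || x (j i))

/-- `X`: the language of encodings of sequential NOR circuits whose output
gate has value 1. -/
def XL : Language Letter :=
  { v | ∃ n j x, 1 ≤ n ∧ ValidIdx j n ∧ GateVals j n x ∧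
          v = encC j n ∧ x n = true }

/-- `Y`: the language of encodings of sequential NOR circuits whose output
gate has value 0. -/
def YL : Language Letter :=
  { v | ∃ n j x, 1 ≤ n ∧ ValidIdx j n ∧ GateVals j n x ∧
          v = encC j n ∧ x n = false }

/-- The language {a}*·{b}. -/
def AstarB : Language Letter :=
  { w | ∃ k, w = List.replicate k Letter.a ++ [Letter.b] }

/-- The language L₀ = ⋃_{m ≥ 0} {a}ᵐ·{b}·({a}*·{b})ᵐ. -/
def L0 : Language Letter :=
  { w | ∃ m, w ∈ ({List.replicate m Letter.a ++ [Letter.b]} : Language Letter)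
                * AstarB ^ m }

theorem replicate_a_append_b_inj {k l : ℕ} {u v : List Letter}
    (h : List.replicate k Letter.a ++ Letter.b :: u =
      List.replicate l Letter.a ++ Letter.b :: v) : k = l ∧ u = v := by
  induction k generalizing l with
  | zero => cases l <;> simp_all [List.replicate_succ]
  | succ k ih =>
    cases l with
    | zero => simp [List.replicate_succ] at h
    | succ l =>
      simp only [List.replicate_succ, List.cons_append, List.cons.injEq, true_and] at h
      simpa using ih h

theorem encC_succ_succ (j : ℕ → ℕ) (i : ℕ) :
    encC j (i + 2) =
      List.replicate (i + 2 - j (i + 2) - 1) Letter.a ++ Letter.b :: encC j (i + 1) := by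
  simp [encC]

theorem encC_ne_nil (j : ℕ → ℕ) (i : ℕ) : encC j (i + 2) ≠ [] := by
  simp [encC_succ_succ]

/-- A valid encoding determines the number of gates and the indices. -/
theorem encC_injective {j j' : ℕ → ℕ} {n n' : ℕ}
    (hj : ValidIdx j (n + 1)) (hj' : ValidIdx j' (n' + 1))
    (h : encC j (n + 1) = encC j' (n' + 1)) :
    n = n' ∧ ∀ i, 2 ≤ i → i ≤ n + 1 → j i = j' i := by
  induction n generalizing n' with
  | zero =>
    cases n' with
    | zero => exact ⟨rfl, fun i _ _ => by omega⟩
    | succ n' => exact absurd h.symm (encC_ne_nil j' n')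
  | succ n ih =>
    cases n' with
    | zero => exact absurd h (encC_ne_nil j n)
    | succ n' =>
      rw [encC_succ_succ, encC_succ_succ] at h
      obtain ⟨hk, ht⟩ := replicate_a_append_b_inj h
      obtain ⟨rfl, hi⟩ := ih (fun i h1 h2 => hj i h1 (by omega))
        (fun i h1 h2 => hj' i h1 (by omega)) ht
      refine ⟨rfl, fun i h1 h2 => ?_⟩
      rcases Nat.lt_or_ge i (n + 2) with h3 | h3
      · exact hi i h1 (by omega)
      · obtain rfl : i = n + 2 := by omega
        have := hj (n + 2) (by omega) le_rfl
        have := hj' (n + 2) (by omega) le_rfl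
        omega

theorem GateVals.unique {j j' : ℕ → ℕ} {n : ℕ} {x x' : ℕ → Bool} (hj : ValidIdx j n)
    (hx : GateVals j n x) (hx' : GateVals j' n x')
    (h : ∀ i, 2 ≤ i → i ≤ n → j i = j' i) :
    ∀ i, 1 ≤ i → i ≤ n → x i = x' i := by
  intro i
  induction i using Nat.strong_induction_on with
  | _ i ih =>
    intro h1 h2
    rcases Nat.lt_or_ge i 2 with h3 | h3
    · obtain rfl : i = 1 := by omega
      rw [hx.1, hx'.1]
    · have := hj i h3 h2
      rw [hx.2 i h3 h2, hx'.2 i h3 h2, ← h i h3 h2, ih (i - 1) (by omega) (by omega) (by omega),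
        ih (j i) (by omega) (by omega) (by omega)]

theorem output_unique {j j' : ℕ → ℕ} {n n' : ℕ} {x x' : ℕ → Bool} (hn : 1 ≤ n) (hn' : 1 ≤ n')
    (hj : ValidIdx j n) (hj' : ValidIdx j' n') (hx : GateVals j n x) (hx' : GateVals j' n' x')
    (h : encC j n = encC j' n') : x n = x' n' := by
  obtain ⟨n, rfl⟩ := Nat.exists_eq_add_of_le' hn
  obtain ⟨n', rfl⟩ := Nat.exists_eq_add_of_le' hn'
  obtain ⟨rfl, hi⟩ := encC_injective hj hj' h
  exact hx.unique hj hx' hi _ hn le_rfl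

theorem encC_mem_XL_iff {j : ℕ → ℕ} {n : ℕ} {x : ℕ → Bool} (hn : 1 ≤ n)
    (hj : ValidIdx j n) (hx : GateVals j n x) : encC j n ∈ XL ↔ x n = true := by
  constructor
  · rintro ⟨n', j', x', hn', hj', hx', h, ht⟩
    rw [output_unique hn hn' hj hj' hx hx' h, ht]
  · exact fun ht => ⟨n, j, x, hn, hj, hx, rfl, ht⟩

theorem encC_mem_YL_iff {j : ℕ → ℕ} {n : ℕ} {x : ℕ → Bool} (hn : 1 ≤ n)
    (hj : ValidIdx j n) (hx : GateVals j n x) : encC j n ∈ YL ↔ x n = false := by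
  constructor
  · rintro ⟨n', j', x', hn', hj', hx', h, ht⟩
    rw [output_unique hn hn' hj hj' hx hx' h, ht]
  · exact fun ht => ⟨n, j, x, hn, hj, hx, rfl, ht⟩

/-- Removing the leading block of an encoding yields the circuit without its last gate. -/
theorem encC_mem_AstarB_mul_iff (j : ℕ → ℕ) (i : ℕ) (L : Language Letter) :
    encC j (i + 2) ∈ AstarB * L ↔ encC j (i + 1) ∈ L := by
  rw [encC_succ_succ, Language.mem_mul]
  constructor
  · rintro ⟨_, ⟨k, rfl⟩, u, hu, h⟩
    rw [List.append_assoc] at h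
    rwa [← (replicate_a_append_b_inj h).2]
  · exact fun h => ⟨_, ⟨i + 2 - j (i + 2) - 1, rfl⟩, _, h, by simp⟩

theorem encC_mem_AstarB_pow_mul_iff (j : ℕ → ℕ) (k m : ℕ) (L : Language Letter) :
    encC j (k + m + 1) ∈ AstarB ^ m * L ↔ encC j (k + 1) ∈ L := by
  induction m with
  | zero => simp
  | succ m ih =>
    rw [pow_succ', mul_assoc, ← ih]
    exact encC_mem_AstarB_mul_iff j (k + m) _

/-- A prefix in `L0` leads from the last gate to the gate that it refers to. -/
theorem encC_mem_L0_mul_iff {j : ℕ → ℕ} {i : ℕ} (h1 : 1 ≤ j (i + 2)) (h2 : j (i + 2) < i + 2)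
    (L : Language Letter) : encC j (i + 2) ∈ L0 * L ↔ encC j (j (i + 2)) ∈ L := by
  have key : encC j (i + 1) ∈ AstarB ^ (i + 2 - j (i + 2) - 1) * L ↔
      encC j (j (i + 2)) ∈ L := by
    have := encC_mem_AstarB_pow_mul_iff j (j (i + 2) - 1) (i + 2 - j (i + 2) - 1) L
    rwa [show j (i + 2) - 1 + (i + 2 - j (i + 2) - 1) + 1 = i + 1 by omega,
      Nat.sub_add_cancel h1] at this
  rw [← key, encC_succ_succ, Language.mem_mul]
  constructor
  · rintro ⟨_, ⟨m, _, rfl, w, hw, rfl⟩, u, hu, h⟩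
    simp only [List.append_assoc, List.cons_append, List.nil_append] at h
    obtain ⟨rfl, ht⟩ := replicate_a_append_b_inj h
    exact ⟨w, hw, u, hu, ht⟩
  · rintro ⟨w, hw, u, hu, h⟩
    exact ⟨_, ⟨_, _, rfl, w, hw, rfl⟩, u, hu, by simp [← h]⟩

/-- The empty string belongs to X, and for every nonempty
circuit encoding v (every nonempty v ∈ X ∪ Y): v ∈ X iff
v ∈ ({a}*{b}·Y) ∩ (L₀·Y), and v ∈ Y iff v ∈ ({a}*{b}·X) ∪ (L₀·X). This is the
statement underlying the 8-rule conjunctive grammar: on well-formed circuit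
encodings, T = AbF ∩ CF ∪ {ε} and F = AbT ∪ CT with Ab = {a}*{b}, C = L₀. -/
theorem statement6 :
    ([] : List Letter) ∈ XL ∧
    ∀ v : List Letter, v ∈ XL ∨ v ∈ YL → v ≠ [] →
      ((v ∈ XL ↔ v ∈ AstarB * YL ∧ v ∈ L0 * YL) ∧
       (v ∈ YL ↔ v ∈ AstarB * XL ∨ v ∈ L0 * XL)) := by
  refine ⟨⟨1, fun _ => 1, fun _ => true, le_rfl, fun i _ _ => by omega,
    ⟨rfl, fun i _ _ => by omega⟩, rfl, rfl⟩, fun v hv hne => ?_⟩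
  obtain ⟨n, j, x, hn, hj, hx, rfl⟩ :
      ∃ n j x, 1 ≤ n ∧ ValidIdx j n ∧ GateVals j n x ∧ v = encC j n := by
    rcases hv with ⟨n, j, x, hn, hj, hx, h, -⟩ | ⟨n, j, x, hn, hj, hx, h, -⟩ <;>
      exact ⟨n, j, x, hn, hj, hx, h⟩
  obtain _ | _ | i := n
  · omega
  · exact absurd rfl hne
  obtain ⟨h1, h2⟩ := hj (i + 2) (by omega) le_rfl
  have hj' : ∀ k ≤ i + 2, ValidIdx j k := fun k hk l hl hlk => hj l hl (hlk.trans hk)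
  have hx' : ∀ k ≤ i + 2, GateVals j k x :=
    fun k hk => ⟨hx.1, fun l hl hlk => hx.2 l hl (hlk.trans hk)⟩
  have hX : ∀ k, 1 ≤ k → k ≤ i + 2 → (encC j k ∈ XL ↔ x k = true) :=
    fun k hk hk' => encC_mem_XL_iff hk (hj' k hk') (hx' k hk')
  have hY : ∀ k, 1 ≤ k → k ≤ i + 2 → (encC j k ∈ YL ↔ x k = false) :=
    fun k hk hk' => encC_mem_YL_iff hk (hj' k hk') (hx' k hk')
  have hval : x (i + 2) = !(x (i + 1) || x (j (i + 2))) := hx.2 (i + 2) (by omega) le_rfl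
  simp only [encC_mem_AstarB_mul_iff, encC_mem_L0_mul_iff h1 h2]
  rw [hX _ hn le_rfl, hY _ hn le_rfl, hX (i + 1) (by omega) (by omega),
    hY (i + 1) (by omega) (by omega), hX _ h1 h2.le, hY _ h1 h2.le, hval]
  cases x (i + 1) <;> cases x (j (i + 2)) <;> simp
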